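/- arXiv:2510.24882 — 3 statements merged into one kernel-verified Lean document; each statement's English description precedes it below -/
import Mathlib

section
/- Let p be a prime and m a positive integer with p ∣ m. Then the number of orbits of the Φ_p state map on (ℤ/mℤ)^(p-1) equals (m^(p-1) − p)/p + p; specifically, there are exactly p fixed points and exactly (m^(p-1) − p)/p orbits of length p. -/
/-- The orbit of a state `v` under a map `f`: all forward iterates of `v`. -/
def orbitOf {α : Type*} (f : α → α) (v : α) : Set α := {w | ∃ k : ℕ, f^[k] v = w}

/-- The set of orbits of a map `f`. -/
def orbitsOf {α : Type*} (f : α → α) : Set (Set α) := Set.range (orbitOf f)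

/-- The Φ_p state map on `(ℤ/mℤ)^(p-1)`: shift left and append
`-(v_0 + ⋯ + v_{p-2})`, the state-transition map of the recurrence
`a_n = -(a_{n-1} + ⋯ + a_{n-p+1})` with characteristic polynomial `Φ_p`. -/
def phiPStep (p m : ℕ) (v : Fin (p - 1) → ZMod m) : Fin (p - 1) → ZMod m :=
  fun i => if h : (i : ℕ) + 1 < p - 1 then v ⟨(i : ℕ) + 1, h⟩ else -(∑ j, v j)

theorem orbitOf_eq_iff_mem {α : Type*} (f : α → α) (p : ℕ) (hp : 0 < p) (hf : ∀ v, f^[p] v = v)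
    (v w : α) : orbitOf f w = orbitOf f v ↔ w ∈ orbitOf f v := by
  have key : ∀ a b : α, b ∈ orbitOf f a → orbitOf f b ⊆ orbitOf f a := by
    rintro a b ⟨k, rfl⟩ c ⟨j, rfl⟩
    exact ⟨j + k, Function.iterate_add_apply f j k a⟩
  constructor
  · intro h
    rw [← h]
    exact ⟨0, rfl⟩
  · intro h
    apply Set.Subset.antisymm (key _ _ h)
    apply key
    obtain ⟨k, rfl⟩ := h
    refine ⟨p * k - k, ?_⟩
    rw [← Function.iterate_add_apply, Nat.sub_add_cancel (Nat.le_mul_of_pos_left k hp)]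
    have : Function.IsPeriodicPt f p v := hf v
    exact this.mul_const k

theorem orbitOf_fixed {α : Type*} (f : α → α) (v : α) (h : f v = v) : orbitOf f v = {v} := by
  ext w
  constructor
  · rintro ⟨k, rfl⟩
    exact Function.iterate_fixed h k
  · rintro rfl
    exact ⟨0, rfl⟩

theorem orbitOf_ncard_prime {α : Type*} (f : α → α) (p : ℕ) (hp : p.Prime)
    (hf : ∀ v, f^[p] v = v) (v : α) (h : f v ≠ v) : (orbitOf f v).ncard = p := by
  have : Fact p.Prime := ⟨hp⟩
  have hmin : Function.minimalPeriod f v = p := Function.minimalPeriod_eq_prime (hf v) h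
  have : orbitOf f v = (fun k => f^[k] v) '' Set.Iio p := by
    ext w
    constructor
    · rintro ⟨k, rfl⟩
      refine ⟨k % p, Nat.mod_lt _ hp.pos, ?_⟩
      have := Function.iterate_mod_minimalPeriod_eq (f := f) (x := v) (n := k)
      rwa [hmin] at this
    · rintro ⟨k, -, rfl⟩
      exact ⟨k, rfl⟩
  rw [this, Set.ncard_image_of_injOn]
  · simp [← Finset.coe_Iio, Set.ncard_coe_finset]
  · have := Function.iterate_injOn_Iio_minimalPeriod (f := f) (x := v)
    rwa [hmin] at this

theorem orbit_count_aux {α : Type*} [Fintype α] (f : α → α) (p : ℕ) (hp : p.Prime)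
    (hf : ∀ v, f^[p] v = v) :
    Fintype.card α = p * {O ∈ orbitsOf f | O.ncard = p}.ncard + {v | f v = v}.ncard ∧
    (orbitsOf f).ncard = {O ∈ orbitsOf f | O.ncard = p}.ncard + {v | f v = v}.ncard := by
  classical
  have hB : {O ∈ orbitsOf f | ¬ O.ncard = p} = (fun v => ({v} : Set α)) '' {v | f v = v} := by
    ext O
    constructor
    · rintro ⟨⟨v, rfl⟩, h⟩
      have hv : f v = v := by
        by_contra hv
        exact h (orbitOf_ncard_prime f p hp hf v hv)
      exact ⟨v, hv, (orbitOf_fixed f v hv).symm⟩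
    · rintro ⟨v, hv, rfl⟩
      refine ⟨⟨v, orbitOf_fixed f v hv⟩, ?_⟩
      simp only [Set.ncard_singleton]
      exact hp.ne_one.symm
  have hBc : {O ∈ orbitsOf f | ¬ O.ncard = p}.ncard = {v | f v = v}.ncard := by
    rw [hB, Set.ncard_image_of_injective _ Set.singleton_injective]
  have hB1 : ∀ O ∈ orbitsOf f, ¬ O.ncard = p → O.ncard = 1 := by
    intro O h1 h2
    have : O ∈ {O ∈ orbitsOf f | ¬ O.ncard = p} := ⟨h1, h2⟩
    rw [hB] at this
    obtain ⟨v, -, rfl⟩ := this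
    simp
  set S : Finset (Set α) := Finset.univ.image (orbitOf f) with hS
  have hSc : (S : Set (Set α)) = orbitsOf f := by
    simp [hS, orbitsOf]
  have hmemS : ∀ O, O ∈ S ↔ O ∈ orbitsOf f := by
    intro O; rw [← hSc]; simp
  have hA' : {O ∈ orbitsOf f | O.ncard = p}.ncard = (S.filter (fun O => O.ncard = p)).card := by
    rw [← Set.ncard_coe_finset]; congr 1; ext O; simp [hmemS]
  have hB' : {O ∈ orbitsOf f | ¬ O.ncard = p}.ncard
      = (S.filter (fun O => ¬ O.ncard = p)).card := by
    rw [← Set.ncard_coe_finset]; congr 1; ext O; simp [hmemS]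
  rw [← hBc, hA', hB', ← hSc, Set.ncard_coe_finset]
  refine ⟨?_, (Finset.card_filter_add_card_filter_not _).symm⟩
  rw [← Finset.card_univ, Finset.card_eq_sum_card_image (orbitOf f) Finset.univ, ← hS]
  have hfib : ∀ O ∈ S, (Finset.univ.filter (fun w => orbitOf f w = O)).card = O.ncard := by
    intro O hO
    obtain ⟨v, rfl⟩ := (hmemS O).1 hO
    rw [← Set.ncard_coe_finset]; congr 1; ext w
    simp [orbitOf_eq_iff_mem f p hp.pos hf]
  rw [Finset.sum_congr rfl hfib, ← Finset.sum_filter_add_sum_filter_not S (fun O => O.ncard = p)]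
  congr 1
  · rw [Finset.sum_congr rfl (g := fun _ => p)]
    · simp [mul_comm]
    · intro O hO; exact (Finset.mem_filter.1 hO).2
  · rw [Finset.sum_congr rfl (g := fun _ => 1)]
    · simp
    · intro O hO
      have := Finset.mem_filter.1 hO
      exact hB1 O ((hmemS O).1 this.1) this.2

/-- The periodic extension of a state to a sequence. -/
def phiSeq (p m : ℕ) (v : Fin (p - 1) → ZMod m) (n : ℕ) : ZMod m :=
  if h : n % p < p - 1 then v ⟨n % p, h⟩ else -(∑ j, v j)

theorem phiSeq_lt (p m : ℕ) (v : Fin (p - 1) → ZMod m) (i : Fin (p - 1)) :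
    phiSeq p m v i = v i := by
  have h : (i : ℕ) % p = i := Nat.mod_eq_of_lt (by omega)
  simp [phiSeq, h]

theorem phiSeq_add (p m : ℕ) (v : Fin (p - 1) → ZMod m) (n : ℕ) :
    phiSeq p m v (n + p) = phiSeq p m v n := by
  simp [phiSeq]

theorem phiSeq_sum (p m : ℕ) (hp : 1 < p) (v : Fin (p - 1) → ZMod m) (k : ℕ) :
    ∑ i ∈ Finset.range p, phiSeq p m v (k + i) = 0 := by
  induction k with
  | zero =>
    obtain ⟨q, rfl⟩ : ∃ q, p = q + 1 := ⟨p - 1, by omega⟩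
    rw [Finset.sum_range_succ, Finset.sum_range]
    have h1 : ∀ i : Fin q, phiSeq (q + 1) m v (0 + i) = v i := by
      intro i; rw [zero_add]; exact phiSeq_lt (q + 1) m v i
    rw [Finset.sum_congr rfl (fun i _ => h1 i)]
    have h2 : phiSeq (q + 1) m v (0 + q) = -(∑ j, v j) := by
      simp [phiSeq]
    rw [h2]
    exact add_neg_cancel _
  | succ k ih =>
    have h1 := Finset.sum_range_succ (fun i => phiSeq p m v (k + i)) p
    have h2 := Finset.sum_range_succ' (fun i => phiSeq p m v (k + i)) p
    rw [h1, ih, phiSeq_add] at h2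
    simp only [add_zero] at h2
    rw [add_left_inj, eq_comm] at h2
    rw [← h2]
    refine Finset.sum_congr rfl fun i _ => ?_
    congr 1; ring

theorem phiPStep_iterate (p m : ℕ) (hp : 1 < p) (v : Fin (p - 1) → ZMod m) (k : ℕ) :
    (phiPStep p m)^[k] v = fun i : Fin (p - 1) => phiSeq p m v (k + (i : ℕ)) := by
  induction k with
  | zero => ext i; simp [phiSeq_lt]
  | succ k ih =>
    rw [Function.iterate_succ_apply', ih]
    ext i
    unfold phiPStep
    split_ifs with h
    · show phiSeq p m v (k + ((i : ℕ) + 1)) = _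
      rw [add_assoc, add_comm 1]
    · have hi : k + 1 + (i : ℕ) = k + (p - 1) := by have := i.2; omega
      have hs := phiSeq_sum p m hp v k
      obtain ⟨q, rfl⟩ : ∃ q, p = q + 1 := ⟨p - 1, by omega⟩
      rw [Finset.sum_range_succ, Finset.sum_range] at hs
      rw [hi]
      exact (eq_neg_of_add_eq_zero_right hs).symm

theorem phiPStep_period (p m : ℕ) (hp : 1 < p) (v : Fin (p - 1) → ZMod m) :
    (phiPStep p m)^[p] v = v := by
  rw [phiPStep_iterate p m hp]
  ext i
  rw [add_comm, phiSeq_add, phiSeq_lt]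

theorem phiPStep_fixed (p m : ℕ) (hp : 1 < p) :
    {v : Fin (p - 1) → ZMod m | phiPStep p m v = v} =
      (fun (c : ZMod m) (_ : Fin (p - 1)) => c) '' {c : ZMod m | p • c = 0} := by
  have hsum : ∀ c : ZMod m, p • c = (∑ _j : Fin (p - 1), c) + c := by
    intro c
    obtain ⟨q, rfl⟩ : ∃ q, p = q + 1 := ⟨p - 1, by omega⟩
    simp [add_mul]
  ext v
  constructor
  · intro h
    have hv : phiPStep p m v = v := h
    have hc : ∀ n (hn : n < p - 1), v ⟨n, hn⟩ = v ⟨0, by omega⟩ := by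
      intro n
      induction n with
      | zero => intro _; rfl
      | succ n ih =>
        intro hn
        rw [← ih (by omega)]
        have := congrFun hv ⟨n, by omega⟩
        simpa [phiPStep, hn] using this
    have hv' : v = fun _ => v ⟨0, by omega⟩ := by
      ext i; exact hc i i.2
    refine ⟨v ⟨0, by omega⟩, ?_, hv'.symm⟩
    have := congrFun hv ⟨p - 2, by omega⟩
    rw [hc] at this
    have hn : ¬ (p - 2 + 1 < p - 1) := by omega
    simp only [phiPStep, hn, dif_neg, not_false_eq_true] at this
    show p • _ = 0
    rw [hsum]
    have hs2 : ∑ _j : Fin (p - 1), v ⟨0, by omega⟩ = ∑ j, v j :=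
      Finset.sum_congr rfl (fun (j : Fin (p - 1)) _ => (hc j j.2).symm)
    rw [hs2]
    rw [← this]
    exact add_neg_cancel _
  · rintro ⟨c, hc, rfl⟩
    have hc' : p • c = 0 := hc
    rw [hsum] at hc'
    show phiPStep p m _ = _
    ext i
    unfold phiPStep
    split_ifs
    · rfl
    · exact (eq_neg_of_add_eq_zero_right hc').symm

theorem phiPStep_fixed_ncard (p m : ℕ) (hp : 1 < p) (hm : 0 < m) (hpm : p ∣ m) :
    {v : Fin (p - 1) → ZMod m | phiPStep p m v = v}.ncard = p := by
  have : NeZero m := ⟨hm.ne'⟩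
  rw [phiPStep_fixed p m hp, Set.ncard_image_of_injective]
  · have := IsAddCyclic.card_nsmulAddMonoidHom_ker (G := ZMod m) p
    rw [Nat.card_zmod, Nat.gcd_eq_right hpm] at this
    exact this
  · intro a b hab
    exact congrFun hab ⟨0, by omega⟩

/-- for a prime `p` with `p ∣ m`, the number of orbits of the Φ_p
state map is `(m^(p-1) - p)/p + p`; there are exactly `p` fixed points and
exactly `(m^(p-1) - p)/p` orbits of length `p`. -/
theorem phiP_orbit_count_of_dvd (p m : ℕ) (hp : p.Prime) (hm : 0 < m) (hpm : p ∣ m) :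
    (orbitsOf (phiPStep p m)).ncard = (m ^ (p - 1) - p) / p + p ∧
    {v : Fin (p - 1) → ZMod m | phiPStep p m v = v}.ncard = p ∧
    {O ∈ orbitsOf (phiPStep p m) | O.ncard = p}.ncard = (m ^ (p - 1) - p) / p := by
  have : NeZero m := ⟨hm.ne'⟩
  obtain ⟨h1, h2⟩ := orbit_count_aux (phiPStep p m) p hp (phiPStep_period p m hp.one_lt)
  have h3 := phiPStep_fixed_ncard p m hp.one_lt hm hpm
  rw [h3] at h1 h2
  have h4 : Fintype.card (Fin (p - 1) → ZMod m) = m ^ (p - 1) := by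
    simp [ZMod.card]
  rw [h4] at h1
  have h5 : (m ^ (p - 1) - p) / p = {O ∈ orbitsOf (phiPStep p m) | O.ncard = p}.ncard := by
    rw [h1, Nat.add_sub_cancel, Nat.mul_div_cancel_left _ hp.pos]
  exact ⟨by rw [h5, h2], h3, h5.symm⟩
end

section
/- Let p be a prime with p ≡ 1 or 4 (mod 5), suppose the Pisano period π(p) satisfies π(p) = (p−1)/α for a positive integer α, and suppose that there is more than one index n with 1 ≤ n ≤ π(p) and p ∣ F_n (where F_n is the n-th Fibonacci number). Then every orbit of the Fibonacci state map T_p on (ℤ/pℤ)² other than the fixed point {(0,0)} has length exactly π(p), and the total number of orbits equals α(p+1) + 1. -/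
/-- The Fibonacci state map `T_m(a, b) = (b, a + b)` on `(ℤ/mℤ)²`, the
state-transition map of the recurrence `a_n = a_{n-1} + a_{n-2}`. -/
def fibStep (m : ℕ) (x : ZMod m × ZMod m) : ZMod m × ZMod m := (x.2, x.1 + x.2)

/-- The Pisano period `π(m)`: the least positive `n` with `T_m^n = id`. -/
noncomputable def pisano (m : ℕ) : ℕ := sInf {n : ℕ | 0 < n ∧ (fibStep m)^[n] = id}

lemma fibStep_iter (p n : ℕ) (v : ZMod p × ZMod p) :
    (fibStep p)^[n] v = (((Nat.fib (n+1) : ZMod p) - Nat.fib n) * v.1 + Nat.fib n * v.2,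
      Nat.fib n * v.1 + Nat.fib (n+1) * v.2) := by
  induction n with
  | zero => simp
  | succ k ih =>
    rw [Function.iterate_succ_apply', ih]
    simp only [fibStep, Nat.fib_add_two, Nat.cast_add]
    ext <;> ring

lemma fib_cassini_zmod (p n : ℕ) :
    (Nat.fib (n+1) : ZMod p) * (Nat.fib (n+1) - Nat.fib n) - (Nat.fib n : ZMod p)^2 = (-1)^n := by
  induction n with
  | zero => simp
  | succ k ih =>
    rw [pow_succ (-1 : ZMod p), ← ih]
    simp only [Nat.fib_add_two, Nat.cast_add]
    ring

lemma fibStep_eq_id (p n : ℕ) (h0 : (Nat.fib n : ZMod p) = 0)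
    (h1 : (Nat.fib (n+1) : ZMod p) = 1) : (fibStep p)^[n] = id := by
  funext v
  rw [fibStep_iter, h0, h1]
  simp

lemma fibStep_scalar (p m : ℕ) (c : ZMod p) (h0 : (Nat.fib m : ZMod p) = 0)
    (h1 : (Nat.fib (m+1) : ZMod p) = c) (k : ℕ) (v : ZMod p × ZMod p) :
    (fibStep p)^[m * k] v = (c ^ k * v.1, c ^ k * v.2) := by
  rw [Function.iterate_mul]
  induction k with
  | zero => simp
  | succ k ih =>
    rw [Function.iterate_succ_apply', ih, fibStep_iter, h0, h1]
    ext <;> simp <;> ring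

/-- A nonzero state fixed by an even power: that power is the identity. -/
lemma fibStep_even (p n : ℕ) [Fact p.Prime] (h2 : (2 : ZMod p) ≠ 0) (h5 : (5 : ZMod p) ≠ 0)
    (hn : Even n) (v : ZMod p × ZMod p) (hv : v ≠ 0) (h : (fibStep p)^[n] v = v) :
    (fibStep p)^[n] = id := by
  obtain ⟨a, b⟩ := v
  have hc := fib_cassini_zmod p n
  rw [hn.neg_one_pow] at hc
  rw [fibStep_iter] at h
  simp only [Prod.mk.injEq] at h
  obtain ⟨e1, e2⟩ := h
  have hd : 2 * (Nat.fib (n+1) : ZMod p) - Nat.fib n = 2 := by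
    generalize (Nat.fib (n+1) : ZMod p) = G at *
    generalize (Nat.fib n : ZMod p) = F at *
    have ha : a * (2 - (2 * G - F)) = 0 := by
      linear_combination (G - 1) * e1 - F * e2 - a * hc
    have hb : b * (2 - (2 * G - F)) = 0 := by
      linear_combination (G - F - 1) * e2 - F * e1 - b * hc
    rcases mul_eq_zero.1 ha with ha | ha
    · rcases mul_eq_zero.1 hb with hb | hb
      · exact absurd (by simp [ha, hb]) hv
      · exact (sub_eq_zero.1 hb).symm
    · exact (sub_eq_zero.1 ha).symm
  have hF : (Nat.fib n : ZMod p) = 0 := by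
    have : (5 : ZMod p) * (Nat.fib n : ZMod p)^2 = 0 := by
      linear_combination (2 * (Nat.fib (n+1) : ZMod p) - Nat.fib n + 2) * hd - 4 * hc
    rcases mul_eq_zero.1 this with h | h
    · exact absurd h h5
    · exact pow_eq_zero_iff (two_ne_zero) |>.1 h
  refine fibStep_eq_id p n hF ?_
  apply mul_left_cancel₀ h2
  rw [hF] at hd
  linear_combination hd

/-- A nonzero state fixed by an odd power: every zero of F mod p is a period. -/
lemma fibStep_odd (p n m : ℕ) [Fact p.Prime]
    (hn : Odd n) (v : ZMod p × ZMod p) (hv : v ≠ 0) (h : (fibStep p)^[n] v = v)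
    (hm : (Nat.fib m : ZMod p) = 0) : (fibStep p)^[m] = id := by
  refine fibStep_eq_id p m hm ?_
  have hc := fib_cassini_zmod p m
  have hs := fibStep_scalar p m _ hm rfl n v
  rw [hm] at hc
  generalize (Nat.fib (m+1) : ZMod p) = c at *
  have hfix : (fibStep p)^[m * n] v = v := by
    have : Function.IsPeriodicPt (fibStep p) n v := h
    exact this.const_mul m
  rw [hfix] at hs
  have hcn : c ^ n = 1 := by
    by_contra hne
    apply hv
    have h1 : (c ^ n - 1) * v.1 = 0 := by
      linear_combination - congrArg Prod.fst hs
    have h2 : (c ^ n - 1) * v.2 = 0 := by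
      linear_combination - congrArg Prod.snd hs
    have h3 := sub_ne_zero.2 hne
    ext
    · simpa [h3] using h1
    · simpa [h3] using h2
  have hc2 : c ^ 2 = (-1) ^ m := by linear_combination hc
  have hc21 : c ^ 2 = 1 := by
    have : ((-1 : ZMod p) ^ m) ^ n = 1 := by
      rw [← hc2, ← pow_mul, mul_comm, pow_mul, hcn, one_pow]
    rw [hc2]
    rwa [← pow_mul, mul_comm, pow_mul, hn.neg_one_pow] at this
  obtain ⟨k, rfl⟩ := hn
  rwa [pow_succ, pow_mul, hc21, one_pow, one_mul] at hcn

lemma orbitOf_ncard {β : Type*} (f : β → β) (v : β) (N : ℕ) (hN : 0 < N)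
    (hper : f^[N] v = v) (hmin : ∀ n, 0 < n → f^[n] v = v → N ≤ n) :
    (orbitOf f v).ncard = N := by
  classical
  have hmp : Function.minimalPeriod f v = N := by
    have hp : Function.IsPeriodicPt f N v := hper
    exact le_antisymm (hp.minimalPeriod_le hN)
      (hmin _ (hp.minimalPeriod_pos hN) (Function.iterate_minimalPeriod))
  have hset : orbitOf f v = ((Finset.range N).image (fun k => f^[k] v) : Finset β) := by
    ext w
    simp only [orbitOf, Set.mem_ofPred_eq, Finset.coe_image, Set.mem_image, Finset.coe_range,
      Set.mem_Iio]
    constructor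
    · rintro ⟨k, rfl⟩
      refine ⟨k % N, Nat.mod_lt _ hN, ?_⟩
      rw [← hmp]
      exact Function.iterate_mod_minimalPeriod_eq
    · rintro ⟨k, _, rfl⟩
      exact ⟨k, rfl⟩
  rw [hset, Set.ncard_coe_finset, Finset.card_image_of_injOn, Finset.card_range]
  intro i hi j hj hij
  simp only [Finset.coe_range, Set.mem_Iio] at hi hj
  rw [← hmp] at hi hj
  exact (Function.iterate_eq_iterate_iff_of_lt_minimalPeriod hi hj).1 hij

lemma orbitOf_eq_iff {β : Type*} (f : β → β) (N : ℕ) (hN : 0 < N) (hid : f^[N] = id) (v w : β) :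
    orbitOf f w = orbitOf f v ↔ w ∈ orbitOf f v := by
  constructor
  · intro h
    rw [← h]
    exact ⟨0, rfl⟩
  · rintro ⟨k, rfl⟩
    ext u
    constructor
    · rintro ⟨j, rfl⟩
      exact ⟨j + k, Function.iterate_add_apply ..⟩
    · rintro ⟨j, rfl⟩
      refine ⟨j + (N * k - k), ?_⟩
      have hk : k ≤ N * k := Nat.le_mul_of_pos_left k hN
      rw [← Function.iterate_add_apply, Nat.add_assoc, Nat.sub_add_cancel hk,
        Function.iterate_add_apply, Function.iterate_mul, hid]
      simp

/-- Subclass B1 primes: if `p ≡ 1, 4 (mod 5)`,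
`π(p) = (p-1)/α` for a positive integer `α`, and more than one index
`1 ≤ n ≤ π(p)` satisfies `p ∣ F_n`, then every orbit of `T_p` other than the
fixed point `{(0,0)}` has length exactly `π(p)`, and the total number of
orbits is `α(p+1) + 1`. -/
theorem fib_orbit_count_classB1 (p α : ℕ) (hp : p.Prime)
    (h5 : p % 5 = 1 ∨ p % 5 = 4) (hα : 0 < α)
    (hπ : pisano p * α = p - 1)
    (hzeros : 1 < ((Finset.Icc 1 (pisano p)).filter fun n => p ∣ Nat.fib n).card) :
    (∀ O ∈ orbitsOf (fibStep p),
      O ≠ {((0 : ZMod p), (0 : ZMod p))} → O.ncard = pisano p) ∧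
    (orbitsOf (fibStep p)).ncard = α * (p + 1) + 1 := by
  classical
  have : Fact p.Prime := ⟨hp⟩
  have hp1 : 1 < p := hp.one_lt
  have hpos : 0 < pisano p := by
    rcases Nat.eq_zero_or_pos (pisano p) with h | h
    · rw [h] at hπ
      omega
    · exact h
  have hid : (fibStep p)^[pisano p] = id := (Nat.sInf_mem (Nat.nonempty_of_pos_sInf hpos)).2
  have hmin : ∀ n, 0 < n → (fibStep p)^[n] = id → pisano p ≤ n :=
    fun n h0 h1 => Nat.sInf_le ⟨h0, h1⟩
  have h2' : (2 : ZMod p) ≠ 0 := by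
    intro h
    have : p ∣ 2 := (ZMod.natCast_eq_zero_iff 2 p).1 (by exact_mod_cast h)
    have := (Nat.prime_dvd_prime_iff_eq hp Nat.prime_two).1 this
    omega
  have h5' : (5 : ZMod p) ≠ 0 := by
    intro h
    have : p ∣ 5 := (ZMod.natCast_eq_zero_iff 5 p).1 (by exact_mod_cast h)
    have := (Nat.prime_dvd_prime_iff_eq hp Nat.prime_five).1 this
    omega
  have hminv : ∀ v : ZMod p × ZMod p, v ≠ 0 → ∀ n, 0 < n → (fibStep p)^[n] v = v →
      pisano p ≤ n := by
    intro v hv n hn h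
    rcases Nat.even_or_odd n with he | ho
    · exact hmin n hn (fibStep_even p n h2' h5' he v hv h)
    · exfalso
      have hsub : ((Finset.Icc 1 (pisano p)).filter fun n => p ∣ Nat.fib n) ⊆ {pisano p} := by
        intro m hm
        simp only [Finset.mem_filter, Finset.mem_Icc] at hm
        obtain ⟨⟨hm1, hm2⟩, hm3⟩ := hm
        have := hmin m hm1 (fibStep_odd p n m ho v hv h ((ZMod.natCast_eq_zero_iff _ _).2 hm3))
        simp only [Finset.mem_singleton]
        omega
      have := Finset.card_le_card hsub
      simp only [Finset.card_singleton] at this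
      omega
  have hcard : ∀ v : ZMod p × ZMod p, v ≠ 0 → (orbitOf (fibStep p) v).ncard = pisano p :=
    fun v hv => orbitOf_ncard _ v _ hpos (by rw [hid]; rfl) (hminv v hv)
  have hzero : orbitOf (fibStep p) 0 = {((0 : ZMod p), (0 : ZMod p))} := by
    ext w
    simp only [orbitOf, Set.mem_ofPred_eq, Set.mem_singleton_iff, fibStep_iter]
    simp [eq_comm]
  have hall : ∀ O ∈ orbitsOf (fibStep p),
      O ≠ {((0 : ZMod p), (0 : ZMod p))} → O.ncard = pisano p := by
    rintro O ⟨v, rfl⟩ hO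
    apply hcard
    rintro rfl
    exact hO hzero
  refine ⟨hall, ?_⟩
  set S : Finset (Set (ZMod p × ZMod p)) := Finset.univ.image (orbitOf (fibStep p)) with hS
  have hSo : orbitsOf (fibStep p) = (S : Set (Set (ZMod p × ZMod p))) := by
    simp [hS, orbitsOf]
  have hsum := Finset.card_eq_sum_card_fiberwise
    (f := orbitOf (fibStep p)) (s := Finset.univ) (t := S) (by
      intro v _
      simp [hS])
  have hfib : ∀ O ∈ S,
      (Finset.univ.filter fun w => orbitOf (fibStep p) w = O).card = O.ncard := by
    intro O hO
    rw [hS, Finset.mem_image] at hO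
    obtain ⟨v, _, rfl⟩ := hO
    rw [← Set.ncard_coe_finset]
    congr 1
    ext w
    simp [orbitOf_eq_iff (fibStep p) _ hpos hid]
  rw [Finset.sum_congr rfl hfib] at hsum
  have h0S : {((0 : ZMod p), (0 : ZMod p))} ∈ S := by
    rw [hS, Finset.mem_image]
    exact ⟨0, Finset.mem_univ _, hzero⟩
  rw [← Finset.add_sum_erase _ _ h0S, Set.ncard_singleton,
    Finset.sum_congr rfl (g := fun _ => pisano p) (by
      intro O hO
      rw [Finset.mem_erase] at hO
      refine hall O ?_ hO.1
      rw [hSo]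
      exact hO.2), Finset.sum_const, smul_eq_mul, Finset.card_univ, Fintype.card_prod,
      ZMod.card] at hsum
  rw [hSo, Set.ncard_coe_finset, ← Finset.card_erase_add_one h0S]
  congr 1
  apply Nat.eq_of_mul_eq_mul_right hpos
  obtain ⟨q, rfl⟩ : ∃ q, p = q + 1 := ⟨p - 1, by omega⟩
  simp only [Nat.add_sub_cancel] at hπ
  have h3 : α * (q + 1 + 1) * pisano (q + 1) = q * (q + 2) := by
    linear_combination (q + 2) * hπ
  rw [h3]
  nlinarith
end

section
/- Let p be a prime with p ≡ 1 or 4 (mod 5), suppose the Pisano period π(p) satisfies π(p) = (p−1)/α for a positive integer α, and suppose that there is exactly one index n with 1 ≤ n ≤ π(p) and p ∣ F_n (where F_n is the n-th Fibonacci number). Then the orbits of the Fibonacci state map T_p on (ℤ/pℤ)² consist of: the fixed point {(0,0)}, exactly 2α orbits of length π(p)/2, and exactly pα orbits of length π(p); in particular the total number of orbits equals α(p+2) + 1. -/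
open Function in
lemma aux_orbit_ncard {X : Type*} [Finite X] (f : X → X) (v : X)
    (hv : v ∈ periodicPts f) : (orbitOf f v).ncard = minimalPeriod f v := by
  have : orbitOf f v = (fun n => f^[n] v) '' (Set.Iio (minimalPeriod f v)) := by
    ext w
    constructor
    · rintro ⟨k, rfl⟩
      exact ⟨k % minimalPeriod f v, Nat.mod_lt _ (minimalPeriod_pos_of_mem_periodicPts hv),
        iterate_mod_minimalPeriod_eq⟩
    · rintro ⟨k, -, rfl⟩
      exact ⟨k, rfl⟩
  rw [this, Set.InjOn.ncard_image]
  · simp [Set.ncard_eq_toFinset_card']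
  · intro a ha b hb hab
    exact (iterate_eq_iterate_iff_of_lt_minimalPeriod ha hb).1 hab

open Function in
lemma aux_orbit_eq {X : Type*} (f : X → X) (N : ℕ) (hN : 0 < N) (hf : f^[N] = id)
    (v w : X) (hw : w ∈ orbitOf f v) : orbitOf f w = orbitOf f v := by
  obtain ⟨k, rfl⟩ := hw
  have hmul : ∀ j, f^[N * j] = id := by
    intro j
    rw [iterate_mul, hf, iterate_id]
  ext u
  constructor
  · rintro ⟨j, rfl⟩
    exact ⟨j + k, iterate_add_apply _ _ _ _⟩
  · rintro ⟨j, rfl⟩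
    refine ⟨j + (N * k - k), ?_⟩
    rw [← iterate_add_apply]
    have : k ≤ N * k := Nat.le_mul_of_pos_left _ hN
    rw [add_assoc, Nat.sub_add_cancel this, iterate_add_apply, hmul]
    rfl

open Function in
lemma aux_count {X : Type*} [Finite X] (f : X → X) (N : ℕ) (hN : 0 < N) (hf : f^[N] = id)
    (n : ℕ) : {O ∈ orbitsOf f | O.ncard = n}.ncard * n = {v | minimalPeriod f v = n}.ncard := by
  classical
  haveI := Fintype.ofFinite X
  have hper : ∀ v, v ∈ periodicPts f := fun v => ⟨N, hN, by
    unfold IsPeriodicPt IsFixedPt; rw [hf]; rfl⟩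
  rw [Set.ncard_eq_toFinset_card', Set.ncard_eq_toFinset_card']
  rw [Finset.card_eq_sum_card_fiberwise (f := orbitOf f)
    (t := {O ∈ orbitsOf f | O.ncard = n}.toFinset)]
  · rw [← smul_eq_mul, ← Finset.sum_const]
    apply Finset.sum_congr rfl
    intro O hO
    simp only [Set.mem_toFinset, Set.mem_setOf_eq] at hO
    obtain ⟨⟨v, rfl⟩, hn⟩ := hO
    rw [← hn, Set.ncard_eq_toFinset_card']
    congr 1
    ext w
    simp only [Set.mem_toFinset, Finset.mem_filter, Set.mem_setOf_eq]
    constructor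
    · intro hw
      have := aux_orbit_eq f N hN hf v w hw
      refine ⟨?_, this⟩
      rw [← aux_orbit_ncard f w (hper w), this]
      simp [Set.ncard_eq_toFinset_card']
    · rintro ⟨-, h⟩
      rw [← h]
      exact ⟨0, rfl⟩
  · intro v hv
    simp only [Set.coe_toFinset, Set.mem_setOf_eq] at hv ⊢
    exact ⟨⟨v, rfl⟩, by rw [aux_orbit_ncard f v (hper v), hv]⟩

lemma aux_iter {p : ℕ} (φ ψ : ZMod p) (hs : φ + ψ = 1) (hm : φ * ψ = -1) (n : ℕ)
    (v : ZMod p × ZMod p) :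
    ((fibStep p)^[n] v).2 - ψ * ((fibStep p)^[n] v).1 = φ ^ n * (v.2 - ψ * v.1) := by
  induction n with
  | zero => simp
  | succ n ih =>
    rw [Function.iterate_succ_apply', pow_succ', mul_assoc, ← ih]
    simp only [fibStep]
    linear_combination (-((fibStep p)^[n] v).2) * hs + ((fibStep p)^[n] v).1 * hm

lemma aux_joint {p : ℕ} [Fact p.Prime] (φ ψ : ZMod p) (hne : φ ≠ ψ) (v w : ZMod p × ZMod p)
    (h1 : v.2 - ψ * v.1 = w.2 - ψ * w.1) (h2 : v.2 - φ * v.1 = w.2 - φ * w.1) : v = w := by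
  have h : (φ - ψ) * (v.1 - w.1) = 0 := by linear_combination h1 - h2
  have h3 : v.1 = w.1 := by
    rcases mul_eq_zero.1 h with h | h
    · exact absurd (sub_eq_zero.1 h) hne
    · exact sub_eq_zero.1 h
  refine Prod.ext h3 ?_
  rw [h3] at h1
  linear_combination h1

lemma aux_fix_iff {p : ℕ} [Fact p.Prime] (φ ψ : ZMod p) (hne : φ ≠ ψ) (hs : φ + ψ = 1)
    (hm : φ * ψ = -1) (n : ℕ) (v : ZMod p × ZMod p) :
    (fibStep p)^[n] v = v ↔
      (φ ^ n = 1 ∨ v.2 - ψ * v.1 = 0) ∧ (ψ ^ n = 1 ∨ v.2 - φ * v.1 = 0) := by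
  have a1 := aux_iter φ ψ hs hm n v
  have a2 := aux_iter ψ φ (by rw [add_comm, hs]) (by rw [mul_comm, hm]) n v
  constructor
  · intro h
    rw [h] at a1 a2
    refine ⟨?_, ?_⟩
    · have : (φ ^ n - 1) * (v.2 - ψ * v.1) = 0 := by linear_combination -a1
      rcases mul_eq_zero.1 this with h | h
      · exact Or.inl (sub_eq_zero.1 h)
      · exact Or.inr h
    · have : (ψ ^ n - 1) * (v.2 - φ * v.1) = 0 := by linear_combination -a2
      rcases mul_eq_zero.1 this with h | h
      · exact Or.inl (sub_eq_zero.1 h)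
      · exact Or.inr h
  · rintro ⟨h1, h2⟩
    apply aux_joint φ ψ hne
    · rw [a1]; rcases h1 with h | h <;> rw [h] <;> simp
    · rw [a2]; rcases h2 with h | h <;> rw [h] <;> simp

lemma aux_id_iff {p : ℕ} [Fact p.Prime] (φ ψ : ZMod p) (hne : φ ≠ ψ) (hs : φ + ψ = 1)
    (hm : φ * ψ = -1) (n : ℕ) :
    (fibStep p)^[n] = id ↔ φ ^ n = 1 ∧ ψ ^ n = 1 := by
  constructor
  · intro h
    have := (aux_fix_iff φ ψ hne hs hm n (0, 1)).1 (by rw [h]; rfl)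
    simpa using this
  · rintro ⟨h1, h2⟩
    funext v
    exact (aux_fix_iff φ ψ hne hs hm n v).2 ⟨Or.inl h1, Or.inl h2⟩

lemma aux_fib {p : ℕ} (φ ψ : ZMod p) (hs : φ + ψ = 1)
    (hm : φ * ψ = -1) (n : ℕ) :
    (φ - ψ) * (Nat.fib n : ZMod p) = φ ^ n - ψ ^ n := by
  have hψ : ψ = 1 - φ := by linear_combination hs
  subst hψ
  induction n using Nat.twoStepInduction with
  | zero => simp
  | one => simp
  | more n ih1 ih2 =>
    rw [Nat.fib_add_two]
    push_cast
    rw [mul_add, ih1, ih2]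
    linear_combination (φ ^ n - (1 - φ) ^ n) * hm

open Function in
lemma aux_core {p : ℕ} [Fact p.Prime] (φ ψ : ZMod p) (hne : φ ≠ ψ) (hs : φ + ψ = 1)
    (hm : φ * ψ = -1) (k α : ℕ) (hk : 1 < k) (h1 : orderOf φ = k) (h2 : orderOf ψ = 2 * k)
    (hα : 2 * k * α = p - 1) :
    {v : ZMod p × ZMod p | fibStep p v = v} = {((0 : ZMod p), (0 : ZMod p))} ∧
    (∀ O ∈ orbitsOf (fibStep p),
      O.ncard = 1 ∨ O.ncard = k ∨ O.ncard = 2 * k) ∧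
    {O ∈ orbitsOf (fibStep p) | O.ncard = k}.ncard = 2 * α ∧
    {O ∈ orbitsOf (fibStep p) | O.ncard = 2 * k}.ncard = p * α ∧
    (orbitsOf (fibStep p)).ncard = α * (p + 2) + 1 := by
  have hN : 0 < 2 * k := by omega
  have hp1 : 1 < p := (Fact.out : p.Prime).one_lt
  have hf : (fibStep p)^[2 * k] = id := (aux_id_iff φ ψ hne hs hm _).2
    ⟨orderOf_dvd_iff_pow_eq_one.1 (h1 ▸ Dvd.intro_left 2 rfl),
     orderOf_dvd_iff_pow_eq_one.1 (h2 ▸ dvd_rfl)⟩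
  have hper : ∀ v, v ∈ periodicPts (fibStep p) := fun v => ⟨2 * k, hN, by
    unfold IsPeriodicPt IsFixedPt; rw [hf]; rfl⟩
  have key : ∀ v n, minimalPeriod (fibStep p) v ∣ n ↔
      (k ∣ n ∨ v.2 - ψ * v.1 = 0) ∧ (2 * k ∣ n ∨ v.2 - φ * v.1 = 0) := by
    intro v n
    rw [← isPeriodicPt_iff_minimalPeriod_dvd]
    have := aux_fix_iff φ ψ hne hs hm n v
    rw [← orderOf_dvd_iff_pow_eq_one, ← orderOf_dvd_iff_pow_eq_one, h1, h2] at this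
    exact this
  have hzero : ∀ v : ZMod p × ZMod p, v.2 - ψ * v.1 = 0 → v.2 - φ * v.1 = 0 → v = (0, 0) := by
    intro v a b
    apply aux_joint φ ψ hne
    · simpa using a
    · simpa using b
  have mp2 : ∀ v : ZMod p × ZMod p, v.2 - φ * v.1 ≠ 0 → minimalPeriod (fibStep p) v = 2 * k := by
    intro v hv
    apply Nat.dvd_antisymm
    · rw [key]
      exact ⟨Or.inl (Dvd.intro_left 2 rfl), Or.inl dvd_rfl⟩
    · exact (((key v _).1 dvd_rfl).2).resolve_right hv
  have mp1 : ∀ v : ZMod p × ZMod p, v.2 - φ * v.1 = 0 → v ≠ (0, 0) →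
      minimalPeriod (fibStep p) v = k := by
    intro v hv hv0
    apply Nat.dvd_antisymm
    · rw [key]
      exact ⟨Or.inl dvd_rfl, Or.inr hv⟩
    · exact (((key v _).1 dvd_rfl).1).resolve_right (fun h => hv0 (hzero v h hv))
  have mp0 : minimalPeriod (fibStep p) ((0, 0) : ZMod p × ZMod p) = 1 := by
    apply Nat.dvd_one.1
    rw [key]
    simp
  have c := aux_count (fibStep p) (2 * k) hN hf
  have hline : {v : ZMod p × ZMod p | v.2 - φ * v.1 = 0}.ncard = p := by
    have : {v : ZMod p × ZMod p | v.2 - φ * v.1 = 0} = (fun a => (a, φ * a)) '' Set.univ := by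
      ext v
      simp only [Set.mem_setOf_eq, Set.image_univ, Set.mem_range]
      constructor
      · intro h
        exact ⟨v.1, Prod.ext rfl (sub_eq_zero.1 h).symm⟩
      · rintro ⟨a, rfl⟩
        simp
    rw [this, Set.ncard_image_of_injective, Set.ncard_univ, Nat.card_zmod]
    intro a b h
    exact (Prod.mk.inj h).1
  have s2 : {v | minimalPeriod (fibStep p) v = 2 * k}
      = {v : ZMod p × ZMod p | v.2 - φ * v.1 = 0}ᶜ := by
    ext v
    simp only [Set.mem_setOf_eq, Set.mem_compl_iff]
    constructor
    · intro h h'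
      by_cases h0 : v = (0, 0)
      · rw [h0, mp0] at h; omega
      · rw [mp1 v h' h0] at h; omega
    · exact mp2 v
  have s1 : {v | minimalPeriod (fibStep p) v = k}
      = {v : ZMod p × ZMod p | v.2 - φ * v.1 = 0} \ {(0, 0)} := by
    ext v
    simp only [Set.mem_setOf_eq, Set.mem_diff, Set.mem_singleton_iff]
    constructor
    · intro h
      constructor
      · by_contra h'
        rw [mp2 v h'] at h; omega
      · rintro rfl
        rw [mp0] at h; omega
    · exact fun h => mp1 v h.1 h.2
  have s0 : {v | minimalPeriod (fibStep p) v = 1} = {((0 : ZMod p), (0 : ZMod p))} := by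
    ext v
    simp only [Set.mem_setOf_eq, Set.mem_singleton_iff]
    constructor
    · intro h
      by_contra h0
      by_cases h' : v.2 - φ * v.1 = 0
      · rw [mp1 v h' h0] at h; omega
      · rw [mp2 v h'] at h; omega
    · rintro rfl
      exact mp0
  have c2 := c (2 * k)
  have c1 := c k
  have c0 := c 1
  rw [s2, Set.ncard_compl, hline] at c2
  rw [s1, Set.ncard_diff_singleton_of_mem (by simp), hline] at c1
  rw [s0, Set.ncard_singleton, mul_one] at c0
  rw [Nat.card_prod, Nat.card_zmod] at c2
  have hall : ∀ O ∈ orbitsOf (fibStep p), O.ncard = 1 ∨ O.ncard = k ∨ O.ncard = 2 * k := by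
    rintro _ ⟨v, rfl⟩
    rw [aux_orbit_ncard _ _ (hper v)]
    by_cases h' : v.2 - φ * v.1 = 0
    · by_cases h0 : v = (0, 0)
      · left; rw [h0, mp0]
      · right; left; exact mp1 v h' h0
    · right; right; exact mp2 v h'
  have n1 : {O ∈ orbitsOf (fibStep p) | O.ncard = k}.ncard = 2 * α := by
    apply Nat.eq_of_mul_eq_mul_right (show 0 < k by omega)
    rw [c1, ← hα]; ring
  have n2 : {O ∈ orbitsOf (fibStep p) | O.ncard = 2 * k}.ncard = p * α := by
    apply Nat.eq_of_mul_eq_mul_right hN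
    rw [c2]
    have : p * p - p = p * (p - 1) := by rw [Nat.mul_sub, mul_one]
    rw [this, ← hα]; ring
  refine ⟨?_, hall, n1, n2, ?_⟩
  · rw [← s0]
    ext v
    exact minimalPeriod_eq_one_iff_isFixedPt.symm
  · have hU : orbitsOf (fibStep p) = {O ∈ orbitsOf (fibStep p) | O.ncard = 1} ∪
        ({O ∈ orbitsOf (fibStep p) | O.ncard = k} ∪
          {O ∈ orbitsOf (fibStep p) | O.ncard = 2 * k}) := by
      ext O
      simp only [Set.mem_union, Set.mem_setOf_eq]
      constructor
      · intro h
        rcases hall O h with h' | h' | h'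
        · exact Or.inl ⟨h, h'⟩
        · exact Or.inr (Or.inl ⟨h, h'⟩)
        · exact Or.inr (Or.inr ⟨h, h'⟩)
      · tauto
    rw [hU, Set.ncard_union_eq, Set.ncard_union_eq, c0, n1, n2]
    · ring
    · rw [Set.disjoint_left]
      rintro O ⟨-, h⟩ ⟨-, h'⟩
      omega
    · rw [Set.disjoint_left]
      rintro O ⟨-, h⟩ (⟨-, h'⟩ | ⟨-, h'⟩) <;> omega

lemma aux_roots {p : ℕ} [Fact p.Prime] (h5 : p % 5 = 1 ∨ p % 5 = 4) (h2 : (2 : ZMod p) ≠ 0)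
    (hp2 : p ≠ 2) :
    ∃ φ ψ : ZMod p, φ ≠ ψ ∧ φ + ψ = 1 ∧ φ * ψ = -1 := by
  haveI : Fact (Nat.Prime 5) := ⟨by norm_num⟩
  have hsq : IsSquare ((5 : ℕ) : ZMod p) := by
    rw [← ZMod.exists_sq_eq_prime_iff_of_mod_four_eq_one (p := 5) (q := p) (by norm_num) hp2]
    rw [← ZMod.natCast_mod p 5]
    rcases h5 with h | h <;> rw [h]
    · exact ⟨1, by norm_num⟩
    · exact ⟨2, by norm_num⟩
  have h50 : ((5 : ℕ) : ZMod p) ≠ 0 := by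
    rw [Ne, ZMod.natCast_eq_zero_iff, Nat.prime_dvd_prime_iff_eq Fact.out Fact.out]
    rintro rfl
    omega
  obtain ⟨s, hs⟩ := hsq
  push_cast at hs h50
  refine ⟨(1 + s) / 2, (1 - s) / 2, ?_, ?_, ?_⟩
  · intro h
    have : s = 0 := by
      field_simp at h
      have : 2 * s = 0 := by linear_combination h
      exact (mul_eq_zero.1 this).resolve_left h2
    rw [this] at hs
    exact h50 (by rw [hs]; simp)
  · field_simp; ring
  · field_simp
    linear_combination hs

lemma aux_order {p : ℕ} [Fact p.Prime] (φ ψ : ZMod p) (h2 : (2 : ZMod p) ≠ 0)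
    (hm : φ * ψ = -1) (k : ℕ) (hk : 0 < k)
    (hmin : ∀ n, φ ^ n = 1 → ψ ^ n = 1 → 2 * k ∣ n) (h1 : φ ^ k = 1) (h3 : ψ ^ k = -1) :
    orderOf φ = k ∧ orderOf ψ = 2 * k := by
  have hmp : ∀ n, φ ^ n * ψ ^ n = (-1) ^ n := fun n => by rw [← mul_pow, hm]
  constructor
  · apply Nat.dvd_antisymm (orderOf_dvd_of_pow_eq_one h1)
    have a : φ ^ (orderOf φ) = 1 := pow_orderOf_eq_one φ
    have b := hmp (orderOf φ)
    rw [a, one_mul] at b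
    have := hmin (2 * orderOf φ) (by rw [mul_comm, pow_mul, a, one_pow])
      (by rw [mul_comm, pow_mul, b, ← pow_mul, mul_comm, pow_mul]; simp)
    exact Nat.dvd_of_mul_dvd_mul_left (by norm_num) this
  · have a : ψ ^ (orderOf ψ) = 1 := pow_orderOf_eq_one ψ
    have b := hmp (orderOf ψ)
    rw [a, mul_one] at b
    have h := hmin (2 * orderOf ψ)
      (by rw [mul_comm, pow_mul, b, ← pow_mul, mul_comm, pow_mul]; simp)
      (by rw [mul_comm, pow_mul, a, one_pow])
    have hd := Nat.dvd_of_mul_dvd_mul_left (by norm_num) h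
    obtain ⟨e, he⟩ := hd
    have hd2 : orderOf ψ ∣ 2 * k := orderOf_dvd_of_pow_eq_one (by
      rw [mul_comm, pow_mul, h3]; simp)
    rw [he, mul_comm 2 k] at hd2
    have he2 := Nat.dvd_of_mul_dvd_mul_left hk hd2
    rcases (Nat.dvd_prime Nat.prime_two).1 he2 with h | h
    · rw [he, h, mul_one, h3] at a
      exfalso; apply h2
      linear_combination -a
    · rw [he, h, mul_comm]

/-- Subclass B2 primes: if `p ≡ 1, 4 (mod 5)`,
`π(p) = (p-1)/α` for a positive integer `α`, and exactly one index
`1 ≤ n ≤ π(p)` satisfies `p ∣ F_n`, then the orbits of `T_p` consist of the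
fixed point `{(0,0)}`, exactly `2α` orbits of length `π(p)/2`, and exactly
`pα` orbits of length `π(p)`; in particular the total number of orbits is
`α(p+2) + 1`. -/
theorem fib_orbit_count_classB2 (p α : ℕ) (hp : p.Prime)
    (h5 : p % 5 = 1 ∨ p % 5 = 4) (hα : 0 < α)
    (hπ : pisano p * α = p - 1)
    (hzeros : ((Finset.Icc 1 (pisano p)).filter fun n => p ∣ Nat.fib n).card = 1) :
    {v : ZMod p × ZMod p | fibStep p v = v} = {((0 : ZMod p), (0 : ZMod p))} ∧
    (∀ O ∈ orbitsOf (fibStep p),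
      O.ncard = 1 ∨ O.ncard = pisano p / 2 ∨ O.ncard = pisano p) ∧
    {O ∈ orbitsOf (fibStep p) | O.ncard = pisano p / 2}.ncard = 2 * α ∧
    {O ∈ orbitsOf (fibStep p) | O.ncard = pisano p}.ncard = p * α ∧
    (orbitsOf (fibStep p)).ncard = α * (p + 2) + 1 := by
  haveI : Fact p.Prime := ⟨hp⟩
  have hp2 : p ≠ 2 := by rintro rfl; omega
  have h2 : (2 : ZMod p) ≠ 0 := by
    have : ((2 : ℕ) : ZMod p) ≠ 0 := by
      rw [Ne, ZMod.natCast_eq_zero_iff, Nat.prime_dvd_prime_iff_eq hp Nat.prime_two]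
      exact hp2
    simpa using this
  obtain ⟨φ, ψ, hne, hs, hm⟩ := aux_roots h5 h2 hp2
  have hp1 := hp.one_lt
  have hpos : 0 < pisano p := by
    rcases Nat.eq_zero_or_pos (pisano p) with h | h
    · rw [h] at hπ; omega
    · exact h
  have hmem : 0 < pisano p ∧ (fibStep p)^[pisano p] = id :=
    Nat.sInf_mem (s := {n : ℕ | 0 < n ∧ (fibStep p)^[n] = id})
      (Nat.nonempty_of_pos_sInf hpos)
  obtain ⟨e1, e2⟩ := (aux_id_iff φ ψ hne hs hm _).1 hmem.2
  have hmin : ∀ n, φ ^ n = 1 → ψ ^ n = 1 → pisano p ∣ n := by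
    intro n a b
    rcases Nat.eq_zero_or_pos (n % pisano p) with h | h
    · exact Nat.dvd_of_mod_eq_zero h
    · exfalso
      have hmod : ∀ x : ZMod p, x ^ pisano p = 1 → x ^ n = 1 → x ^ (n % pisano p) = 1 := by
        intro x hx hn
        rw [← Nat.mod_add_div n (pisano p), pow_add, pow_mul, hx, one_pow, mul_one] at hn
        exact hn
      have : pisano p ≤ n % pisano p := Nat.sInf_le
        ⟨h, (aux_id_iff φ ψ hne hs hm _).2 ⟨hmod φ e1 a, hmod ψ e2 b⟩⟩
      exact absurd (Nat.mod_lt n hpos) (by omega)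
  have hdvd : ∀ n, φ ^ n = ψ ^ n → p ∣ Nat.fib n := by
    intro n h
    have := aux_fib φ ψ hs hm n
    rw [h, sub_self] at this
    rw [← ZMod.natCast_eq_zero_iff]
    exact (mul_eq_zero.1 this).resolve_left (sub_ne_zero.2 hne)
  have huniq : ∀ n, 0 < n → n ≤ pisano p → φ ^ n = ψ ^ n → n = pisano p := by
    intro n h0 hn h
    apply Finset.card_le_one.1 hzeros.le
    · simp only [Finset.mem_filter, Finset.mem_Icc]
      exact ⟨⟨h0, hn⟩, hdvd n h⟩
    · simp only [Finset.mem_filter, Finset.mem_Icc]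
      exact ⟨⟨hpos, le_rfl⟩, hdvd _ (by rw [e1, e2])⟩
  have hev : Even (pisano p) := by
    by_contra h
    have h' := Nat.not_even_iff_odd.1 h
    have : (φ * ψ) ^ pisano p = 1 := by rw [mul_pow, e1, e2, one_mul]
    rw [hm, h'.neg_one_pow] at this
    apply h2
    linear_combination -this
  obtain ⟨k, hk⟩ := hev
  have hk' : pisano p = 2 * k := by omega
  rw [hk'] at hπ hpos hmin huniq e1 e2 ⊢
  have hdiv : 2 * k / 2 = k := by omega
  rw [hdiv]
  have hk0 : 0 < k := by omega
  have hk1 : ∀ x y : ZMod p, x + y = 1 → x * y = -1 → x ^ k = 1 → 1 < k := by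
    intro x y hx hxy h
    by_contra hk1
    have : k = 1 := by omega
    rw [this, pow_one] at h
    subst h
    have hy : y = 0 := by linear_combination hx
    rw [hy, mul_zero] at hxy
    exact one_ne_zero (α := ZMod p) (by linear_combination hxy)
  have f1 : φ ^ k = 1 ∨ φ ^ k = -1 := by
    rw [← sq_eq_one_iff, ← pow_mul, mul_comm, e1]
  have f2 : ψ ^ k = 1 ∨ ψ ^ k = -1 := by
    rw [← sq_eq_one_iff, ← pow_mul, mul_comm, e2]
  have fne : φ ^ k ≠ ψ ^ k := fun h => by
    have := huniq k hk0 (by omega) h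
    omega
  have hm' : ψ * φ = -1 := by rw [mul_comm, hm]
  have hs' : ψ + φ = 1 := by rw [add_comm, hs]
  rcases f1 with f1 | f1 <;> rcases f2 with f2 | f2
  · exact absurd (f1.trans f2.symm) fne
  · obtain ⟨o1, o2⟩ := aux_order φ ψ h2 hm k hk0 hmin f1 f2
    exact aux_core φ ψ hne hs hm k α (hk1 φ ψ hs hm f1) o1 o2 hπ
  · obtain ⟨o1, o2⟩ := aux_order ψ φ h2 hm' k hk0 (fun n a b => hmin n b a) f2 f1
    exact aux_core ψ φ hne.symm hs' hm' k α (hk1 ψ φ hs' hm' f2) o1 o2 hπ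
  · exact absurd (f1.trans f2.symm) fne
end
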